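/- Let d ≥ 1, s ∈ (0,1), and use the Fourier convention F w(ξ) = ∫_{ℝ^d} w(x) e^{−i x·ξ} dx with inverse F^{−1} g(x) = (2π)^{−d} ∫_{ℝ^d} g(ξ) e^{i x·ξ} dξ. Then for every Schwartz function w : ℝ^d → ℝ and every x ∈ ℝ^d, the function y ↦ (2w(x) − w(x+y) − w(x−y))/|y|^{d+2s} is Lebesgue integrable on ℝ^d, the function ξ ↦ |ξ|^{2s} F w(ξ) e^{i x·ξ} is Lebesgue integrable on ℝ^d, and (C(d,s)/2) ∫_{ℝ^d} (2w(x) − w(x+y) − w(x−y))/|y|^{d+2s} dy = (2π)^{−d} ∫_{ℝ^d} |ξ|^{2s} F w(ξ) e^{i x·ξ} dξ. -/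

import Mathlib

open MeasureTheory Real Set
open scoped RealInnerProductSpace

/-- The normalization constant `C(d,s) = 2^(2s) s Γ(s+d/2) / (π^(d/2) Γ(1-s))` of the
integral fractional Laplacian. -/
noncomputable def fracLapConst (d : ℕ) (s : ℝ) : ℝ :=
  2 ^ (2 * s) * s * Real.Gamma (s + d / 2) / (π ^ ((d : ℝ) / 2) * Real.Gamma (1 - s))

/-- Fourier transform with the convention `F w (ξ) = ∫ w(x) e^{-i x·ξ} dx`. -/
noncomputable def fourierConv {d : ℕ} (w : EuclideanSpace ℝ (Fin d) → ℝ)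
    (ξ : EuclideanSpace ℝ (Fin d)) : ℂ :=
  ∫ x : EuclideanSpace ℝ (Fin d), (w x : ℂ) * Complex.exp (-Complex.I * (⟪x, ξ⟫ : ℝ))


lemma lintegral_rpow_mul_exp_neg_mul_Ioi {a b : ℝ} (ha : 0 < a) (hb : 0 < b) :
    ∫⁻ t in Ioi (0 : ℝ), ENNReal.ofReal (t ^ (a - 1) * Real.exp (-(b * t))) =
      ENNReal.ofReal (b ^ (-a) * Real.Gamma a) := by
  have h := Real.integral_rpow_mul_exp_neg_mul_Ioi ha hb
  have hne : (1 / b) ^ a * Real.Gamma a ≠ 0 :=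
    (mul_pos (by positivity) (Real.Gamma_pos_of_pos ha)).ne'
  have hint : IntegrableOn (fun t : ℝ => t ^ (a - 1) * Real.exp (-(b * t))) (Ioi 0) := by
    by_contra hcon
    exact hne (h ▸ integral_undef hcon)
  rw [← ofReal_integral_eq_lintegral_ofReal hint, h, one_div, Real.inv_rpow hb.le,
    Real.rpow_neg hb.le]
  filter_upwards [ae_restrict_mem measurableSet_Ioi] with t ht
  have : 0 < t := ht
  simp only [Pi.zero_apply]
  positivity

lemma lintegral_rpow_mul_exp_neg_div_Ioi {s b : ℝ} (hs : s < 1) (hb : 0 < b) :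
    ∫⁻ t in Ioi (0 : ℝ), ENNReal.ofReal (t ^ (s - 2) * Real.exp (-(b / t))) =
      ENNReal.ofReal (b ^ (s - 1) * Real.Gamma (1 - s)) := by
  have h := Real.integral_rpow_mul_exp_neg_mul_Ioi (a := 1 - s) (by linarith) hb
  have hne : (1 / b) ^ (1 - s) * Real.Gamma (1 - s) ≠ 0 :=
    (mul_pos (by positivity) (Real.Gamma_pos_of_pos (by linarith))).ne'
  rw [← integral_comp_rpow_Ioi _ (show (-1 : ℝ) ≠ 0 by norm_num)] at h
  have hcongr : ∫ t in Ioi (0 : ℝ), t ^ (s - 2) * Real.exp (-(b / t)) =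
      (1 / b) ^ (1 - s) * Real.Gamma (1 - s) := by
    rw [← h]
    refine setIntegral_congr_fun measurableSet_Ioi fun t (ht : 0 < t) => ?_
    simp only [smul_eq_mul, abs_neg, abs_one, one_mul]
    rw [← mul_assoc, ← Real.rpow_mul ht.le, ← Real.rpow_add ht, Real.rpow_neg_one, div_eq_mul_inv]
    congr 2
    ring
  have hint : IntegrableOn (fun t : ℝ => t ^ (s - 2) * Real.exp (-(b / t))) (Ioi 0) := by
    by_contra hcon
    exact hne (hcongr ▸ integral_undef hcon)
  rw [← ofReal_integral_eq_lintegral_ofReal hint, hcongr, one_div, Real.inv_rpow hb.le,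
    ← Real.rpow_neg hb.le, neg_sub]
  filter_upwards [ae_restrict_mem measurableSet_Ioi] with t ht
  have : 0 < t := ht
  simp only [Pi.zero_apply]
  positivity

lemma lintegral_exp_neg_div_Ioc {a t : ℝ} (ha : 0 ≤ a) (ht : 0 < t) :
    ∫⁻ b in Ioc 0 a, ENNReal.ofReal (t⁻¹ * Real.exp (-(b / t))) =
      ENNReal.ofReal (1 - Real.exp (-(a / t))) := by
  have hcont : Continuous fun b : ℝ => t⁻¹ * Real.exp (-(b / t)) := by fun_prop
  have h : ∫ b in (0 : ℝ)..a, t⁻¹ * Real.exp (-(b / t)) = 1 - Real.exp (-(a / t)) := by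
    rw [intervalIntegral.integral_eq_sub_of_hasDerivAt
      (f := fun b : ℝ => -Real.exp (-(b / t))) _ (hcont.intervalIntegrable _ _)]
    · simp
      ring
    · intro b _
      convert! (((hasDerivAt_id b).div_const t).neg.exp).neg using 1
      simp
      ring
  rw [← ofReal_integral_eq_lintegral_ofReal, ← intervalIntegral.integral_of_le ha, h]
  · exact (hcont.intervalIntegrable 0 a).1
  · filter_upwards with b
    simp only [Pi.zero_apply]
    positivity

lemma lintegral_rpow_mul_one_sub_exp_neg_div_Ioi {s a : ℝ} (hs : s ∈ Ioo (0 : ℝ) 1)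
    (ha : 0 ≤ a) :
    ∫⁻ t in Ioi (0 : ℝ), ENNReal.ofReal (t ^ (s - 1) * (1 - Real.exp (-(a / t)))) =
      ENNReal.ofReal (a ^ s * Real.Gamma (1 - s) / s) := by
  have hΓ : 0 < Real.Gamma (1 - s) := Real.Gamma_pos_of_pos (by linarith [hs.2])
  calc
    _ = ∫⁻ t in Ioi (0 : ℝ), ∫⁻ b in Ioc 0 a,
          ENNReal.ofReal (t ^ (s - 2) * Real.exp (-(b / t))) := by
      refine setLIntegral_congr_fun measurableSet_Ioi fun t (ht : 0 < t) => ?_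
      rw [ENNReal.ofReal_mul (by positivity), ← lintegral_exp_neg_div_Ioc ha ht,
        ← lintegral_const_mul _ (by fun_prop)]
      refine lintegral_congr fun b => ?_
      rw [← ENNReal.ofReal_mul (by positivity), ← mul_assoc, ← Real.rpow_neg_one,
        ← Real.rpow_add ht]
      congr 3
      ring
    _ = ∫⁻ b in Ioc 0 a, ∫⁻ t in Ioi (0 : ℝ),
          ENNReal.ofReal (t ^ (s - 2) * Real.exp (-(b / t))) :=
      lintegral_lintegral_swap (by
        apply Measurable.aemeasurable
        unfold Function.uncurry
        fun_prop)
    _ = ∫⁻ b in Ioc 0 a, ENNReal.ofReal (b ^ (s - 1) * Real.Gamma (1 - s)) :=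
      setLIntegral_congr_fun measurableSet_Ioc fun b hb =>
        lintegral_rpow_mul_exp_neg_div_Ioi hs.2 hb.1
    _ = _ := by
      rw [← ofReal_integral_eq_lintegral_ofReal, ← intervalIntegral.integral_of_le ha,
        intervalIntegral.integral_mul_const, integral_rpow (Or.inl (by linarith [hs.1]))]
      · rw [sub_add_cancel, Real.zero_rpow hs.1.ne', sub_zero, div_mul_eq_mul_div]
      · exact ((intervalIntegral.intervalIntegrable_rpow' (a := 0) (b := a)
          (by linarith [hs.1])).mul_const _).1
      · filter_upwards [ae_restrict_mem measurableSet_Ioc] with b hb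
        have := hb.1
        simp only [Pi.zero_apply]
        positivity

lemma lintegral_one_sub_cos_mul_gaussian {V : Type*} [NormedAddCommGroup V]
    [InnerProductSpace ℝ V] [FiniteDimensional ℝ V] [MeasurableSpace V] [BorelSpace V]
    {t : ℝ} (ht : 0 < t) (ξ : V) :
    ∫⁻ y : V, ENNReal.ofReal ((1 - Real.cos ⟪ξ, y⟫) * Real.exp (-(‖y‖ ^ 2 * t))) =
      ENNReal.ofReal ((π / t) ^ ((Module.finrank ℝ V : ℝ) / 2) *
        (1 - Real.exp (-(‖ξ‖ ^ 2 / 4 / t)))) := by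
  have ht' : 0 < (t : ℂ).re := ht
  have hint := GaussianFourier.integrable_cexp_neg_mul_sq_norm_add ht' Complex.I ξ
  have hint0 := GaussianFourier.integrable_cexp_neg_mul_sq_norm_add ht' 0 ξ
  have hI := GaussianFourier.integral_cexp_neg_mul_sq_norm_add ht' Complex.I ξ
  have hI0 := GaussianFourier.integral_cexp_neg_mul_sq_norm_add ht' 0 ξ
  have hre : ∀ y : V, (Complex.exp (-(t : ℂ) * ‖y‖ ^ 2 + 0 * (⟪ξ, y⟫ : ℝ)) -
      Complex.exp (-(t : ℂ) * ‖y‖ ^ 2 + Complex.I * (⟪ξ, y⟫ : ℝ))).re =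
      (1 - Real.cos ⟪ξ, y⟫) * Real.exp (-(‖y‖ ^ 2 * t)) := by
    intro y
    rw [Complex.sub_re, Complex.exp_re, Complex.exp_re]
    simp [← Complex.ofReal_pow]
    ring_nf
  have hsub := (hint0.sub hint).re
  have heq : ∫ y : V, (1 - Real.cos ⟪ξ, y⟫) * Real.exp (-(‖y‖ ^ 2 * t)) =
      (π / t) ^ ((Module.finrank ℝ V : ℝ) / 2) * (1 - Real.exp (-(‖ξ‖ ^ 2 / 4 / t))) := by
    simp_rw [← hre]
    have := integral_re (hint0.sub hint)
    simp only [Pi.sub_apply, RCLike.re_eq_complex_re] at this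
    rw [this, integral_sub hint0 hint, hI, hI0]
    have h1 : ((π : ℂ) / t) ^ ((Module.finrank ℝ V : ℂ) / 2) =
        (((π / t) ^ ((Module.finrank ℝ V : ℝ) / 2) : ℝ) : ℂ) := by
      rw [Complex.ofReal_cpow (by positivity)]
      push_cast
      rfl
    have h2 : Complex.exp (Complex.I ^ 2 * ‖ξ‖ ^ 2 / (4 * t)) =
        ((Real.exp (-(‖ξ‖ ^ 2 / 4 / t)) : ℝ) : ℂ) := by
      push_cast
      congr 1
      rw [Complex.I_sq]
      ring
    rw [h1, h2, ← mul_sub, Complex.re_ofReal_mul, Complex.sub_re, Complex.ofReal_re]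
    simp
  rw [← heq, ← ofReal_integral_eq_lintegral_ofReal]
  · refine hsub.congr (Filter.Eventually.of_forall fun y => ?_)
    exact hre y
  · filter_upwards with y
    simp only [Pi.zero_apply]
    exact mul_nonneg (by linarith [Real.cos_le_one ⟪ξ, y⟫]) (by positivity)

lemma fracLapConst_pos {d : ℕ} {s : ℝ} (hs : s ∈ Ioo (0 : ℝ) 1) : 0 < fracLapConst d s := by
  have h0 := hs.1
  have h1 : 0 < Real.Gamma (s + d / 2) := Real.Gamma_pos_of_pos (by positivity)
  have h2 : 0 < Real.Gamma (1 - s) := Real.Gamma_pos_of_pos (by linarith [hs.2])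
  unfold fracLapConst
  positivity

lemma lintegral_one_sub_cos_div_norm_rpow (d : ℕ) {s : ℝ} (hs : s ∈ Ioo (0 : ℝ) 1)
    (ξ : EuclideanSpace ℝ (Fin d)) :
    ∫⁻ y : EuclideanSpace ℝ (Fin d),
        ENNReal.ofReal ((1 - Real.cos ⟪ξ, y⟫) / ‖y‖ ^ ((d : ℝ) + 2 * s)) =
      ENNReal.ofReal ((fracLapConst d s)⁻¹ * ‖ξ‖ ^ (2 * s)) := by
  have h0 := hs.1
  have hp : 0 < s + (d : ℝ) / 2 := by positivity
  have hΓ : 0 < Real.Gamma (s + d / 2) := Real.Gamma_pos_of_pos hp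
  have hΓ' : 0 < Real.Gamma (1 - s) := Real.Gamma_pos_of_pos (by linarith [hs.2])
  have hcos : ∀ y : EuclideanSpace ℝ (Fin d), 0 ≤ 1 - Real.cos ⟪ξ, y⟫ := fun y => by
    linarith [Real.cos_le_one ⟪ξ, y⟫]
  calc
    _ = ∫⁻ y : EuclideanSpace ℝ (Fin d), ∫⁻ t in Ioi (0 : ℝ),
          ENNReal.ofReal ((Real.Gamma (s + d / 2))⁻¹ * t ^ (s + d / 2 - 1)) *
          ENNReal.ofReal ((1 - Real.cos ⟪ξ, y⟫) * Real.exp (-(‖y‖ ^ 2 * t))) := by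
      refine lintegral_congr fun y => ?_
      rcases eq_or_ne y 0 with rfl | hy
      · simp
      have hy' : 0 < ‖y‖ := norm_pos_iff.mpr hy
      have hc := hcos y
      trans ENNReal.ofReal ((1 - Real.cos ⟪ξ, y⟫) * (Real.Gamma (s + d / 2))⁻¹) *
        ENNReal.ofReal ((‖y‖ ^ 2) ^ (-(s + (d : ℝ) / 2)) * Real.Gamma (s + d / 2))
      · rw [← ENNReal.ofReal_mul (by positivity), ← Real.rpow_natCast, ← Real.rpow_mul hy'.le]
        congr 1
        have : ((2 : ℕ) : ℝ) * -(s + (d : ℝ) / 2) = -(d + 2 * s) := by push_cast; ring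
        rw [this, Real.rpow_neg hy'.le]
        field_simp
      · rw [← lintegral_rpow_mul_exp_neg_mul_Ioi hp (by positivity),
          ← lintegral_const_mul _ (by fun_prop)]
        refine setLIntegral_congr_fun measurableSet_Ioi fun t (ht : 0 < t) => ?_
        rw [← ENNReal.ofReal_mul (by positivity), ← ENNReal.ofReal_mul (by positivity)]
        congr 1
        ring
    _ = ∫⁻ t in Ioi (0 : ℝ), ∫⁻ y : EuclideanSpace ℝ (Fin d),
          ENNReal.ofReal ((Real.Gamma (s + d / 2))⁻¹ * t ^ (s + d / 2 - 1)) *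
          ENNReal.ofReal ((1 - Real.cos ⟪ξ, y⟫) * Real.exp (-(‖y‖ ^ 2 * t))) :=
      lintegral_lintegral_swap (by
        apply Measurable.aemeasurable
        unfold Function.uncurry
        fun_prop)
    _ = ∫⁻ t in Ioi (0 : ℝ), ENNReal.ofReal ((Real.Gamma (s + d / 2))⁻¹ * π ^ ((d : ℝ) / 2)) *
          ENNReal.ofReal (t ^ (s - 1) * (1 - Real.exp (-(‖ξ‖ ^ 2 / 4 / t)))) := by
      refine setLIntegral_congr_fun measurableSet_Ioi fun t (ht : 0 < t) => ?_
      rw [lintegral_const_mul _ (by fun_prop), lintegral_one_sub_cos_mul_gaussian ht,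
        ← ENNReal.ofReal_mul (by positivity), ← ENNReal.ofReal_mul (by positivity),
        finrank_euclideanSpace_fin, Real.div_rpow pi_pos.le ht.le]
      have : t ^ (s + (d : ℝ) / 2 - 1) = t ^ (s - 1) * t ^ ((d : ℝ) / 2) := by
        rw [← Real.rpow_add ht]
        congr 1
        ring
      rw [this]
      congr 1
      field_simp
    _ = _ := by
      rw [lintegral_const_mul _ (by fun_prop),
        lintegral_rpow_mul_one_sub_exp_neg_div_Ioi hs (by positivity),
        ← ENNReal.ofReal_mul (by positivity)]
      congr 1
      have h4 : (4 : ℝ) ^ s = 2 ^ (2 * s) := by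
        rw [Real.rpow_mul (by norm_num)]
        norm_num
      have hn : (‖ξ‖ ^ 2) ^ s = ‖ξ‖ ^ (2 * s) := by
        rw [Real.rpow_mul (norm_nonneg _)]
        norm_num
      rw [Real.div_rpow (by positivity) (by norm_num), h4, hn, fracLapConst]
      field_simp

section FourierInversion

open scoped FourierTransform SchwartzMap

variable {d : ℕ} (w : 𝓢(EuclideanSpace ℝ (Fin d), ℝ))

lemma fourierConv_eq_fourier (ξ : EuclideanSpace ℝ (Fin d)) :
    fourierConv (fun z => w z) ξ =
      𝓕 (w.postcompCLM Complex.ofRealCLM) ((2 * π)⁻¹ • ξ) := by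
  rw [SchwartzMap.fourier_coe, Real.fourier_eq', fourierConv]
  refine integral_congr_ae (Filter.Eventually.of_forall fun z => ?_)
  simp only [SchwartzMap.postcompCLM_apply, Complex.ofRealCLM_apply, smul_eq_mul,
    real_inner_smul_right]
  rw [mul_comm]
  congr 2
  have : -2 * π * ((2 * π)⁻¹ * ⟪z, ξ⟫) = -⟪z, ξ⟫ := by field_simp
  rw [this]
  push_cast
  ring

lemma continuous_fourierConv : Continuous (fourierConv (fun z => w z)) := by
  simp_rw [funext (fourierConv_eq_fourier w)]
  exact (SchwartzMap.continuous _).comp (continuous_const_smul _)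

lemma integrable_fourierConv : Integrable (fourierConv (fun z => w z)) := by
  simp_rw [funext (fourierConv_eq_fourier w)]
  exact (SchwartzMap.integrable (𝓕 (w.postcompCLM Complex.ofRealCLM))).comp_smul (by positivity)

lemma integrable_norm_sq_mul_fourierConv :
    Integrable fun ξ => ‖ξ‖ ^ 2 * ‖fourierConv (fun z => w z) ξ‖ := by
  simp_rw [fourierConv_eq_fourier w]
  have h := (((𝓕 (w.postcompCLM Complex.ofRealCLM)).integrable_pow_mul volume 2).comp_smul
    (show (2 * π)⁻¹ ≠ 0 by positivity)).const_mul ((2 * π) ^ 2)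
  refine h.congr (Filter.Eventually.of_forall fun ξ => ?_)
  simp only [norm_smul, norm_inv, Real.norm_of_nonneg (show 0 ≤ 2 * π by positivity)]
  field_simp

lemma integrable_norm_rpow_mul_fourierConv {s : ℝ} (hs : s ∈ Ioo (0 : ℝ) 1) :
    Integrable fun ξ => ‖ξ‖ ^ (2 * s) * ‖fourierConv (fun z => w z) ξ‖ := by
  have hc := continuous_fourierConv w
  refine ((integrable_fourierConv w).norm.add (integrable_norm_sq_mul_fourierConv w)).mono'
    ?_ (Filter.Eventually.of_forall fun ξ => ?_)
  · exact ((continuous_norm.rpow_const fun _ => Or.inr (by linarith [hs.1])).mul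
      hc.norm).aestronglyMeasurable
  · rw [Real.norm_of_nonneg (by positivity)]
    have key : ‖ξ‖ ^ (2 * s) ≤ 1 + ‖ξ‖ ^ 2 := by
      rcases le_total ‖ξ‖ 1 with h | h
      · have := Real.rpow_le_one (norm_nonneg ξ) h (show 0 ≤ 2 * s by linarith [hs.1])
        nlinarith [sq_nonneg ‖ξ‖]
      · have := Real.rpow_le_rpow_of_exponent_le h (show 2 * s ≤ 2 by linarith [hs.2])
        rw [Real.rpow_two] at this
        linarith
    calc _ ≤ (1 + ‖ξ‖ ^ 2) * ‖fourierConv (fun z => w z) ξ‖ := by gcongr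
      _ = _ := by simp only [Pi.add_apply]; ring

lemma integrable_fourierConv_mul_exp (z : EuclideanSpace ℝ (Fin d)) :
    Integrable fun ξ => fourierConv (fun z => w z) ξ * Complex.exp (Complex.I * (⟪z, ξ⟫ : ℝ)) := by
  refine (integrable_fourierConv w).mul_bdd (c := 1) ?_ (Filter.Eventually.of_forall fun ξ => ?_)
  · exact Continuous.aestronglyMeasurable (by fun_prop)
  · rw [mul_comm, Complex.norm_exp_ofReal_mul_I]

lemma integral_fourierConv_mul_exp (z : EuclideanSpace ℝ (Fin d)) :
    ∫ ξ, fourierConv (fun z => w z) ξ * Complex.exp (Complex.I * (⟪z, ξ⟫ : ℝ)) =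
      (2 * π : ℂ) ^ d * w z := by
  set W : 𝓢(EuclideanSpace ℝ (Fin d), ℂ) := w.postcompCLM Complex.ofRealCLM with hW
  have hinv : 𝓕⁻ (⇑(𝓕 W : 𝓢(EuclideanSpace ℝ (Fin d), ℂ))) z = (w z : ℂ) := by
    rw [← SchwartzMap.fourierInv_coe, FourierTransform.fourierInv_fourier_eq]
    rfl
  rw [← hinv, Real.fourierInv_eq']
  have := Measure.integral_comp_smul (volume : Measure (EuclideanSpace ℝ (Fin d)))
    (fun v => Complex.exp ((↑(2 * π * ⟪v, z⟫) * Complex.I)) •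
      (𝓕 W : 𝓢(EuclideanSpace ℝ (Fin d), ℂ)) v) (2 * π)⁻¹
  rw [finrank_euclideanSpace_fin, inv_pow, inv_inv, abs_of_nonneg (by positivity)] at this
  rw [Complex.real_smul] at this
  push_cast at this ⊢
  rw [← this]
  refine integral_congr_ae (Filter.Eventually.of_forall fun ξ => ?_)
  simp only [fourierConv_eq_fourier w, ← hW, smul_eq_mul, real_inner_smul_left]
  rw [mul_comm]
  congr 2
  rw [real_inner_comm]
  have : (π : ℂ) ≠ 0 := by exact_mod_cast pi_ne_zero
  push_cast
  field_simp

lemma integral_one_sub_cos_mul_fourierConv (x y : EuclideanSpace ℝ (Fin d)) :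
    ∫ ξ, ((1 - Real.cos ⟪ξ, y⟫ : ℝ) : ℂ) *
        (fourierConv (fun z => w z) ξ * Complex.exp (Complex.I * (⟪x, ξ⟫ : ℝ))) =
      (2 * π : ℂ) ^ d / 2 * ((2 * w x - w (x + y) - w (x - y) : ℝ) : ℂ) := by
  have h0 := integrable_fourierConv_mul_exp w x
  have h1 := integrable_fourierConv_mul_exp w (x + y)
  have h2 := integrable_fourierConv_mul_exp w (x - y)
  have hpt : ∀ ξ, ((1 - Real.cos ⟪ξ, y⟫ : ℝ) : ℂ) *
      (fourierConv (fun z => w z) ξ * Complex.exp (Complex.I * (⟪x, ξ⟫ : ℝ))) =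
      fourierConv (fun z => w z) ξ * Complex.exp (Complex.I * (⟪x, ξ⟫ : ℝ)) -
      2⁻¹ * (fourierConv (fun z => w z) ξ * Complex.exp (Complex.I * (⟪x + y, ξ⟫ : ℝ)) +
        fourierConv (fun z => w z) ξ * Complex.exp (Complex.I * (⟪x - y, ξ⟫ : ℝ))) := by
    intro ξ
    have ha : Complex.exp (Complex.I * (⟪x + y, ξ⟫ : ℝ)) =
        Complex.exp (Complex.I * (⟪x, ξ⟫ : ℝ)) * Complex.exp ((⟪ξ, y⟫ : ℝ) * Complex.I) := by
      rw [← Complex.exp_add, inner_add_left, real_inner_comm ξ y]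
      push_cast
      ring_nf
    have hb : Complex.exp (Complex.I * (⟪x - y, ξ⟫ : ℝ)) =
        Complex.exp (Complex.I * (⟪x, ξ⟫ : ℝ)) * Complex.exp (-(⟪ξ, y⟫ : ℝ) * Complex.I) := by
      rw [← Complex.exp_add, inner_sub_left, real_inner_comm ξ y]
      push_cast
      ring_nf
    rw [ha, hb, Complex.ofReal_sub, Complex.ofReal_cos, Complex.cos]
    push_cast
    ring
  simp_rw [hpt]
  rw [integral_sub h0 (by exact (h1.add h2).const_mul _), integral_const_mul, integral_add h1 h2,
    integral_fourierConv_mul_exp, integral_fourierConv_mul_exp, integral_fourierConv_mul_exp]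
  push_cast
  ring

end FourierInversion

lemma integrable_prod_ofReal_mul {α β : Type*} [MeasurableSpace α] [MeasurableSpace β]
    {μ : Measure α} {ν : Measure β} [SFinite μ] [SFinite ν] {k : β → α → ℝ} {g : β → ℂ}
    (hk : Measurable fun p : α × β => k p.2 p.1) (hk0 : ∀ b a, 0 ≤ k b a)
    (hki : ∀ b, Integrable (k b) μ) (hg : Measurable g)
    (hint : Integrable (fun b => (∫ a, k b a ∂μ) * ‖g b‖) ν) :
    Integrable (fun p : α × β => (k p.2 p.1 : ℂ) * g p.2) (μ.prod ν) := by
  have hm : Measurable fun p : α × β => (k p.2 p.1 : ℂ) * g p.2 :=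
    (Complex.measurable_ofReal.comp hk).mul (hg.comp measurable_snd)
  rw [integrable_prod_iff' hm.aestronglyMeasurable]
  refine ⟨Filter.Eventually.of_forall fun b => ?_, ?_⟩
  · have h : Integrable (fun a => (k b a : ℂ)) μ := (hki b).ofReal
    exact h.mul_const (g b)
  · refine hint.congr (Filter.Eventually.of_forall fun b => ?_)
    simp only [norm_mul, Complex.norm_real, Real.norm_of_nonneg (hk0 b _)]
    rw [integral_mul_const]

/-- Equivalence of the singular-integral and Fourier definitions of `(-Δ)^s` on Schwartz
functions: for every Schwartz `w` and every `x`, both integrands below are integrable and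
`(C(d,s)/2) ∫ (2w(x)-w(x+y)-w(x-y))/|y|^(d+2s) dy
   = (2π)^(-d) ∫ |ξ|^(2s) F w (ξ) e^{i x·ξ} dξ`. -/
theorem fracLap_pointwise_eq_fourier
    (d : ℕ) (hd : 1 ≤ d) (s : ℝ) (hs : s ∈ Set.Ioo (0 : ℝ) 1)
    (w : SchwartzMap (EuclideanSpace ℝ (Fin d)) ℝ) (x : EuclideanSpace ℝ (Fin d)) :
    MeasureTheory.Integrable (fun y : EuclideanSpace ℝ (Fin d) =>
        (2 * w x - w (x + y) - w (x - y)) / ‖y‖ ^ ((d : ℝ) + 2 * s)) ∧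
      MeasureTheory.Integrable (fun ξ : EuclideanSpace ℝ (Fin d) =>
        ((‖ξ‖ ^ (2 * s) : ℝ) : ℂ) * fourierConv (fun z => w z) ξ *
          Complex.exp (Complex.I * (⟪x, ξ⟫ : ℝ))) ∧
      ((fracLapConst d s / 2 *
          ∫ y : EuclideanSpace ℝ (Fin d),
            (2 * w x - w (x + y) - w (x - y)) / ‖y‖ ^ ((d : ℝ) + 2 * s) : ℝ) : ℂ) =
        (((2 * π) ^ (-(d : ℝ)) : ℝ) : ℂ) *
          ∫ ξ : EuclideanSpace ℝ (Fin d),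
            ((‖ξ‖ ^ (2 * s) : ℝ) : ℂ) * fourierConv (fun z => w z) ξ *
              Complex.exp (Complex.I * (⟪x, ξ⟫ : ℝ)) := by
  have hC := fracLapConst_pos (d := d) hs
  have hcos : ∀ ξ y : EuclideanSpace ℝ (Fin d),
      0 ≤ (1 - Real.cos ⟪ξ, y⟫) / ‖y‖ ^ ((d : ℝ) + 2 * s) := fun ξ y =>
    div_nonneg (by linarith [Real.cos_le_one ⟪ξ, y⟫]) (by positivity)
  have hmeas : Measurable fun p : EuclideanSpace ℝ (Fin d) × EuclideanSpace ℝ (Fin d) =>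
      (1 - Real.cos ⟪p.2, p.1⟫) / ‖p.1‖ ^ ((d : ℝ) + 2 * s) := by fun_prop
  have hslice : ∀ ξ : EuclideanSpace ℝ (Fin d), Integrable fun y : EuclideanSpace ℝ (Fin d) =>
      (1 - Real.cos ⟪ξ, y⟫) / ‖y‖ ^ ((d : ℝ) + 2 * s) := fun ξ =>
    ⟨(hmeas.comp measurable_prodMk_right).aestronglyMeasurable, by
      rw [hasFiniteIntegral_iff_ofReal (Filter.Eventually.of_forall (hcos ξ)),
        lintegral_one_sub_cos_div_norm_rpow d hs]
      exact ENNReal.ofReal_lt_top⟩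
  have hsliceInt : ∀ ξ : EuclideanSpace ℝ (Fin d), ∫ y : EuclideanSpace ℝ (Fin d),
      (1 - Real.cos ⟪ξ, y⟫) / ‖y‖ ^ ((d : ℝ) + 2 * s) =
      (fracLapConst d s)⁻¹ * ‖ξ‖ ^ (2 * s) := fun ξ => by
    rw [integral_eq_lintegral_of_nonneg_ae (Filter.Eventually.of_forall (hcos ξ)) (hslice ξ).1,
      lintegral_one_sub_cos_div_norm_rpow d hs, ENNReal.toReal_ofReal (by positivity)]
  set g : EuclideanSpace ℝ (Fin d) → ℂ := fun ξ =>
    fourierConv (fun z => w z) ξ * Complex.exp (Complex.I * (⟪x, ξ⟫ : ℝ)) with hg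
  have hgnorm : ∀ ξ, ‖g ξ‖ = ‖fourierConv (fun z => w z) ξ‖ := fun ξ => by
    rw [hg, norm_mul, mul_comm Complex.I, Complex.norm_exp_ofReal_mul_I, mul_one]
  have hgcont : Continuous g := by
    have := continuous_fourierConv w
    fun_prop
  have hnorm := integrable_norm_rpow_mul_fourierConv w hs
  have hjoint : Integrable (fun p : EuclideanSpace ℝ (Fin d) × EuclideanSpace ℝ (Fin d) =>
      (((1 - Real.cos ⟪p.2, p.1⟫) / ‖p.1‖ ^ ((d : ℝ) + 2 * s) : ℝ) : ℂ) * g p.2)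
      (volume.prod volume) := by
    refine integrable_prod_ofReal_mul hmeas hcos hslice hgcont.measurable ?_
    simp_rw [hsliceInt, hgnorm, mul_assoc]
    exact hnorm.const_mul _
  have hinner : ∀ y : EuclideanSpace ℝ (Fin d),
      ∫ ξ, (((1 - Real.cos ⟪ξ, y⟫) / ‖y‖ ^ ((d : ℝ) + 2 * s) : ℝ) : ℂ) * g ξ =
      (2 * π : ℂ) ^ d / 2 *
        (((2 * w x - w (x + y) - w (x - y)) / ‖y‖ ^ ((d : ℝ) + 2 * s) : ℝ) : ℂ) := by
    intro y
    have h := integral_one_sub_cos_mul_fourierConv w x y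
    have hpt : ∀ ξ, (((1 - Real.cos ⟪ξ, y⟫) / ‖y‖ ^ ((d : ℝ) + 2 * s) : ℝ) : ℂ) * g ξ =
        ((‖y‖ ^ ((d : ℝ) + 2 * s) : ℝ) : ℂ)⁻¹ * (((1 - Real.cos ⟪ξ, y⟫ : ℝ) : ℂ) * g ξ) :=
      fun ξ => by
        rw [Complex.ofReal_div]
        ring
    simp_rw [hpt]
    rw [integral_const_mul, h, Complex.ofReal_div]
    ring
  have hpi : (2 * π : ℂ) ^ d ≠ 0 := by
    have : (π : ℂ) ≠ 0 := by exact_mod_cast pi_ne_zero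
    exact pow_ne_zero _ (mul_ne_zero two_ne_zero this)
  refine ⟨?_, ?_, ?_⟩
  · have h := hjoint.integral_prod_left
    simp only [hinner] at h
    have h' := (h.const_mul ((2 * π : ℂ) ^ d / 2)⁻¹).re
    refine h'.congr (Filter.Eventually.of_forall fun y => ?_)
    simp only [RCLike.re_eq_complex_re]
    rw [inv_mul_cancel_left₀ (div_ne_zero hpi two_ne_zero), Complex.ofReal_re]
  · refine hnorm.mono' ?_ (Filter.Eventually.of_forall fun ξ => ?_)
    · simp_rw [mul_assoc]
      exact ((Complex.measurable_ofReal.comp (measurable_norm.pow_const _)).mul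
        hgcont.measurable).aestronglyMeasurable
    · rw [mul_assoc, norm_mul, Complex.norm_real, Real.norm_of_nonneg (by positivity)]
      exact (congrArg _ (hgnorm ξ)).le
  · have hswap := integral_integral_swap (μ := volume) (ν := volume) (f := fun y ξ =>
      (((1 - Real.cos ⟪ξ, y⟫) / ‖y‖ ^ ((d : ℝ) + 2 * s) : ℝ) : ℂ) * g ξ) hjoint
    simp_rw [hinner, integral_mul_const, integral_const_mul, integral_complex_ofReal, hsliceInt]
      at hswap
    have hfac : ∀ ξ, (((fracLapConst d s)⁻¹ * ‖ξ‖ ^ (2 * s) : ℝ) : ℂ) * g ξ =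
        (fracLapConst d s : ℂ)⁻¹ * (((‖ξ‖ ^ (2 * s) : ℝ) : ℂ) * g ξ) := fun ξ => by
      push_cast
      ring
    simp_rw [hfac, integral_const_mul] at hswap
    simp_rw [mul_assoc (((‖_‖ ^ (2 * s) : ℝ) : ℂ))]
    have hC' : (fracLapConst d s : ℂ) ≠ 0 := by exact_mod_cast hC.ne'
    rw [inv_mul_eq_div, eq_div_iff hC'] at hswap
    rw [← hswap, Real.rpow_neg (by positivity), Real.rpow_natCast]
    push_cast
    field_simp
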